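/- arXiv:2402.11981 — 3 statements merged into one kernel-verified Lean document; each statement's English description precedes it below -/
import Mathlib

section
/- Suppose ρ_crit > 0. Then there exists λ_low > 0 (depending only on Ξ, c, F and P) such that for every δ ∈ (0,1), setting α := 48(‖F‖∞ + 1/λ_low)(I_F + 2/λ_low) + (2‖F‖∞/λ_low)·√(2 log(2/δ)) and β := 96 I_F/λ_low + (4‖F‖∞/λ_low)·√(2 log(4/δ)), whenever n > 16(α+β)²/ρ_crit² and ρ > α/√n, the event { R̂_ρ(f) ≥ E_{ξ∼P}[f(ξ)] for all f ∈ F } has probability at least 1 − δ under the n-fold product measure P^{⊗n} governing the i.i.d. sample ξ_1, …, ξ_n. -/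
open MeasureTheory Filter Set
open scoped ENNReal NNReal

noncomputable section

/-- The `t`-packing number of `F` for the uniform norm: the maximal cardinality of a
subset of `F` whose elements are pairwise at distance at least `t`. -/
def packingNum {Ξ : Type*} [TopologicalSpace Ξ] [CompactSpace Ξ]
    (F : Set C(Ξ, ℝ)) (t : ℝ) : ℝ≥0∞ :=
  ⨆ (s : Finset C(Ξ, ℝ)) (_ : ↑s ⊆ F ∧ (s : Set C(Ξ, ℝ)).Pairwise fun f g => t ≤ dist f g),
    (s.card : ℝ≥0∞)

/-- Dudley's entropy integral of `F`. -/
def dudleyEntropy {Ξ : Type*} [TopologicalSpace Ξ] [CompactSpace Ξ] (F : Set C(Ξ, ℝ)) : ℝ :=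
  ∫ t in Ioi (0 : ℝ), Real.sqrt (Real.log ((packingNum F t).toReal))

/-- `‖F‖∞ = sup_{f ∈ F} ‖f‖∞`. -/
def supNormF {Ξ : Type*} [TopologicalSpace Ξ] [CompactSpace Ξ] (F : Set C(Ξ, ℝ)) : ℝ :=
  ⨆ f : F, ‖(f : C(Ξ, ℝ))‖

/-- Optimal transport cost `W_c(Q, Q')`. -/
def transportCost {Ξ : Type*} [MeasurableSpace Ξ] (c : Ξ → Ξ → ℝ) (Q Q' : Measure Ξ) : ℝ :=
  sInf { r | ∃ π : Measure (Ξ × Ξ), IsProbabilityMeasure π ∧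
    π.map Prod.fst = Q ∧ π.map Prod.snd = Q' ∧ r = ∫ p, c p.1 p.2 ∂π }

/-- The Wasserstein robust risk `R_{ρ,Q}(f)`. -/
def robustRisk {Ξ : Type*} [MeasurableSpace Ξ] (c : Ξ → Ξ → ℝ) (ρ : ℝ)
    (Q : Measure Ξ) (f : Ξ → ℝ) : ℝ :=
  sSup { r | ∃ Q' : Measure Ξ, IsProbabilityMeasure Q' ∧ transportCost c Q Q' ≤ ρ ∧
    r = ∫ ξ, f ξ ∂Q' }

/-- Empirical measure `P̂_n` of a sample `ω`. -/
def empiricalMeasure {Ξ : Type*} [MeasurableSpace Ξ] (n : ℕ) (ω : Fin n → Ξ) : Measure Ξ :=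
  (n : ℝ≥0∞)⁻¹ • ∑ i : Fin n, Measure.dirac (ω i)

/-- Set of maximizers of `f` over `Ξ`. -/
def argmaxSet {Ξ : Type*} [TopologicalSpace Ξ] (f : C(Ξ, ℝ)) : Set Ξ := {ζ | ∀ ξ, f ξ ≤ f ζ}

/-- The critical radius `ρ_crit`. -/
def rhoCrit {Ξ : Type*} [TopologicalSpace Ξ] [MeasurableSpace Ξ]
    (c : Ξ → Ξ → ℝ) (P : Measure Ξ) (F : Set C(Ξ, ℝ)) : ℝ :=
  ⨅ f : F, ∫ ξ, sInf (c ξ '' argmaxSet (f : C(Ξ, ℝ))) ∂P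

/-- The maximal radius `ρ_max(λ)`. -/
def rhoMax {Ξ : Type*} [TopologicalSpace Ξ] [MeasurableSpace Ξ]
    (c : Ξ → Ξ → ℝ) (P : Measure Ξ) (F : Set C(Ξ, ℝ)) (lam : ℝ) : ℝ :=
  ⨅ f : F, ∫ ξ,
    sInf (c ξ '' {ζ | ∀ ζ', (f : C(Ξ, ℝ)) ζ' - lam * c ξ ζ' ≤ (f : C(Ξ, ℝ)) ζ - lam * c ξ ζ}) ∂P

/-- The dual generator `φ(λ, f, ξ) = sup_ζ (f(ζ) - λ c(ξ, ζ))`. -/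
def dualGen {Ξ : Type*} (c : Ξ → Ξ → ℝ) (lam : ℝ) (f : Ξ → ℝ) (ξ : Ξ) : ℝ :=
  ⨆ ζ, (f ζ - lam * c ξ ζ)

/-- `ψ(μ, f, ξ) = μ φ(μ⁻¹, f, ξ)`. -/
def psiGen {Ξ : Type*} (c : Ξ → Ξ → ℝ) (μ : ℝ) (f : Ξ → ℝ) (ξ : Ξ) : ℝ :=
  μ * dualGen c μ⁻¹ f ξ

section EmpiricalProcess

variable {Ξ : Type*} [MetricSpace Ξ] [CompactSpace Ξ] [MeasurableSpace Ξ] [BorelSpace Ξ]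

lemma integrable_continuousMap (P : Measure Ξ) [IsFiniteMeasure P] (h : C(Ξ, ℝ)) :
    Integrable h P :=
  h.continuous.integrable_of_hasCompactSupport (HasCompactSupport.of_compactSpace h)

omit [MetricSpace Ξ] [CompactSpace Ξ] [BorelSpace Ξ] in
lemma isProbabilityMeasure_empiricalMeasure {n : ℕ} (hn : n ≠ 0) (ω : Fin n → Ξ) :
    IsProbabilityMeasure (empiricalMeasure n ω) := by
  constructor
  simp only [empiricalMeasure, Measure.smul_apply, Measure.finsetSum_apply, measure_univ,
    Finset.sum_const, Finset.card_univ, Fintype.card_fin, smul_eq_mul, nsmul_eq_mul, mul_one]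
  exact ENNReal.inv_mul_cancel (by exact_mod_cast hn) (by simp)

lemma integral_empiricalMeasure (n : ℕ) (ω : Fin n → Ξ) (h : C(Ξ, ℝ)) :
    ∫ ξ, h ξ ∂(empiricalMeasure n ω) = (n : ℝ)⁻¹ * ∑ i, h (ω i) := by
  rw [empiricalMeasure, integral_smul_measure,
    integral_finsetSum_measure fun i _ => integrable_continuousMap _ h]
  simp

/-- Deviation of the empirical mean of `h` below its expectation. -/
def deviation (P : Measure Ξ) (n : ℕ) (ω : Fin n → Ξ) (h : C(Ξ, ℝ)) : ℝ :=
  ∫ ξ, h ξ ∂P - ∫ ξ, h ξ ∂(empiricalMeasure n ω)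

lemma deviation_sub (P : Measure Ξ) [IsProbabilityMeasure P] {n : ℕ} (hn : n ≠ 0)
    (ω : Fin n → Ξ) (f g : C(Ξ, ℝ)) :
    deviation P n ω (f - g) = deviation P n ω f - deviation P n ω g := by
  have := isProbabilityMeasure_empiricalMeasure hn ω
  simp only [deviation, ContinuousMap.sub_apply]
  rw [integral_sub (integrable_continuousMap _ _) (integrable_continuousMap _ _),
    integral_sub (integrable_continuousMap _ _) (integrable_continuousMap _ _)]
  ring

omit [BorelSpace Ξ] in
lemma abs_integral_le_norm (P : Measure Ξ) [IsProbabilityMeasure P] (h : C(Ξ, ℝ)) :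
    |∫ ξ, h ξ ∂P| ≤ ‖h‖ := by
  simpa using norm_integral_le_of_norm_le_const (μ := P) (C := ‖h‖)
    (Eventually.of_forall fun x => h.norm_coe_le_norm x)

omit [BorelSpace Ξ] in
lemma deviation_le (P : Measure Ξ) [IsProbabilityMeasure P] {n : ℕ} (hn : n ≠ 0)
    (ω : Fin n → Ξ) (h : C(Ξ, ℝ)) : deviation P n ω h ≤ 2 * ‖h‖ := by
  have := isProbabilityMeasure_empiricalMeasure hn ω
  have h1 := abs_le.1 (abs_integral_le_norm P h)
  have h2 := abs_le.1 (abs_integral_le_norm (empiricalMeasure n ω) h)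
  unfold deviation
  linarith [h1.2, h2.1]

/-- Hoeffding's inequality for the deviation of a bounded function. -/
lemma measure_deviation_gt_le (P : Measure Ξ) [IsProbabilityMeasure P] {n : ℕ} (hn : n ≠ 0)
    {h : C(Ξ, ℝ)} {r L : ℝ} (hr : 0 < r) (hL : 0 ≤ L) (hh : ‖h‖ ≤ r) :
    Measure.pi (fun _ : Fin n => P) {ω | r * √(2 * L) / √n < deviation P n ω h} ≤
      ENNReal.ofReal (Real.exp (-L)) := by
  have hn0 : (0 : ℝ) < n := by exact_mod_cast Nat.pos_of_ne_zero hn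
  have hb : ∀ x, (-h) x ∈ Icc (-r) r := fun x => by
    have := abs_le.1 ((h.norm_coe_le_norm x).trans hh)
    simp only [ContinuousMap.neg_apply, mem_Icc]
    constructor <;> linarith [this.1, this.2]
  have hsub := ProbabilityTheory.hasSubgaussianMGF_of_mem_Icc (μ := P)
    (-h).continuous.measurable.aemeasurable (Eventually.of_forall hb)
  set Y : Ξ → ℝ := fun x => (-h) x - ∫ x, (-h) x ∂P with hY
  have hYm : Measurable Y := (-h).continuous.measurable.sub_const _
  have hind : ProbabilityTheory.iIndepFun (fun (i : Fin n) (ω : Fin n → Ξ) => Y (ω i))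
      (Measure.pi fun _ : Fin n => P) :=
    ProbabilityTheory.iIndepFun_pi (X := fun _ => Y) fun _ => hYm.aemeasurable
  have hs : ∀ i : Fin n, ProbabilityTheory.HasSubgaussianMGF
      (fun ω : Fin n → Ξ => Y (ω i)) ((‖r - -r‖₊ / 2) ^ 2) (Measure.pi fun _ : Fin n => P) := by
    intro i
    have hm := measurePreserving_eval (fun _ : Fin n => P) i
    refine ProbabilityTheory.HasSubgaussianMGF.of_map (Y := Function.eval i) (X := Y)
      hm.measurable.aemeasurable ?_
    rw [hm.map_eq]
    exact hsub
  have key := ProbabilityTheory.HasSubgaussianMGF.measure_sum_ge_le_of_iIndepFun hind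
    (s := Finset.univ) (fun i _ => hs i) (ε := r * √(2 * L) * √n) (by positivity)
  have hc : (((‖r - -r‖₊ / 2) ^ 2 : ℝ≥0) : ℝ) = r ^ 2 := by
    have : r - -r = 2 * r := by ring
    simp [this, abs_of_pos hr]
  have he : -(r * √(2 * L) * √n) ^ 2 /
      (2 * ((∑ _i : Fin n, (‖r - -r‖₊ / 2) ^ 2 : ℝ≥0) : ℝ)) = -L := by
    rw [NNReal.coe_sum, Finset.sum_const, hc, mul_pow, mul_pow,
      Real.sq_sqrt (by positivity), Real.sq_sqrt (by positivity)]
    simp only [Finset.card_univ, Fintype.card_fin, nsmul_eq_mul]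
    field_simp
  rw [he] at key
  refine le_trans (measure_mono ?_) ((ENNReal.le_ofReal_iff_toReal_le (measure_ne_top _ _)
    (Real.exp_pos _).le).2 key)
  intro ω hω
  simp only [mem_ofPred_eq, deviation, integral_empiricalMeasure, hY,
    ContinuousMap.neg_apply, integral_neg, sub_neg_eq_add] at hω ⊢
  rw [Finset.sum_add_distrib, Finset.sum_neg_distrib, Finset.sum_const, Finset.card_univ,
    Fintype.card_fin, nsmul_eq_mul]
  rw [div_lt_iff₀ (by positivity)] at hω
  have hq : √(n : ℝ) * √n = n := Real.mul_self_sqrt hn0.le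
  calc r * √(2 * L) * √n
      ≤ ((∫ x, h x ∂P - (n : ℝ)⁻¹ * ∑ i, h (ω i)) * √n) * √n := by gcongr
    _ = _ := by rw [mul_assoc, hq]; field_simp; ring

/-- Union bound over countably many finite families of bounded functions. -/
lemma ofReal_one_sub_le_measure_forall_deviation_le (P : Measure Ξ) [IsProbabilityMeasure P]
    {n : ℕ} (hn : n ≠ 0) {H : ℕ → Finset C(Ξ, ℝ)} {r N : ℕ → ℝ} (hr : ∀ k, 0 < r k)
    (hH : ∀ k, ∀ h ∈ H k, ‖h‖ ≤ r k) (hN : ∀ k, 1 ≤ N k) (hHN : ∀ k, ((H k).card : ℝ) ≤ N k)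
    {δ : ℝ} (hδ : δ ∈ Ioo (0 : ℝ) 1) :
    ENNReal.ofReal (1 - δ) ≤ Measure.pi (fun _ : Fin n => P)
      {ω | ∀ k, ∀ h ∈ H k, deviation P n ω h ≤
        r k * √(2 * (Real.log (N k) + (k + 1) * Real.log 2 + Real.log δ⁻¹)) / √n} := by
  set μ := Measure.pi (fun _ : Fin n => P)
  set G := {ω | ∀ k, ∀ h ∈ H k, deviation P n ω h ≤
        r k * √(2 * (Real.log (N k) + (k + 1) * Real.log 2 + Real.log δ⁻¹)) / √n} with hG
  set L : ℕ → ℝ := fun k => Real.log (N k) + (k + 1) * Real.log 2 + Real.log δ⁻¹ with hLdef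
  have hL : ∀ k, 0 ≤ L k := fun k => by
    have h1 := Real.log_nonneg (hN k)
    have h2 : 0 ≤ Real.log δ⁻¹ := Real.log_nonneg ((one_le_inv₀ hδ.1).2 hδ.2.le)
    have h3 : 0 ≤ Real.log 2 := Real.log_nonneg (by norm_num)
    simp only [hLdef]
    positivity
  have hexp : ∀ k, Real.exp (-L k) = (N k)⁻¹ * (δ * (1 / 2) ^ (k + 1)) := fun k => by
    have h0 : (0 : ℝ) < N k := zero_lt_one.trans_le (hN k)
    have : -L k = Real.log ((N k)⁻¹ * (δ * (1 / 2) ^ (k + 1))) := by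
      rw [Real.log_mul (by positivity) (mul_pos hδ.1 (by positivity)).ne',
        Real.log_mul hδ.1.ne' (by positivity), Real.log_pow, Real.log_inv, one_div, Real.log_inv]
      simp only [hLdef, Real.log_inv]
      push_cast
      ring
    rw [this, Real.exp_log]
    have := hδ.1
    positivity
  have hcompl : μ Gᶜ ≤ ENNReal.ofReal δ := by
    have hsub : Gᶜ ⊆ ⋃ k, ⋃ h ∈ H k, {ω | r k * √(2 * L k) / √n < deviation P n ω h} := by
      intro ω hω
      simpa [hG, hLdef] using hω
    have hsum : HasSum (fun k : ℕ => δ * (1 / 2 : ℝ) ^ (k + 1)) δ := by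
      convert hasSum_geometric_two' δ using 2 with k
      rw [pow_succ, one_div, inv_pow]
      field_simp
    calc μ Gᶜ ≤ ∑' k, μ (⋃ h ∈ H k, {ω | r k * √(2 * L k) / √n < deviation P n ω h}) :=
          (measure_mono hsub).trans (measure_iUnion_le _)
      _ ≤ ∑' k, ENNReal.ofReal (δ * (1 / 2) ^ (k + 1)) := by
          refine ENNReal.tsum_le_tsum fun k => ?_
          calc _ ≤ ∑ h ∈ H k, μ {ω | r k * √(2 * L k) / √n < deviation P n ω h} :=
                measure_biUnion_finset_le _ _
            _ ≤ ∑ h ∈ H k, ENNReal.ofReal (Real.exp (-L k)) :=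
                Finset.sum_le_sum fun h hh =>
                  measure_deviation_gt_le P hn (hr k) (hL k) (hH k h hh)
            _ = ENNReal.ofReal ((H k).card * Real.exp (-L k)) := by
                rw [Finset.sum_const, nsmul_eq_mul, ENNReal.ofReal_mul (by positivity),
                  ENNReal.ofReal_natCast]
            _ ≤ _ := by
                refine ENNReal.ofReal_le_ofReal ?_
                have h0 : (0 : ℝ) < N k := zero_lt_one.trans_le (hN k)
                have := hδ.1
                calc (H k).card * Real.exp (-L k) ≤ N k * Real.exp (-L k) := by
                      gcongr
                      exact hHN k
                  _ = _ := by rw [hexp k]; field_simp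
      _ = ENNReal.ofReal δ := by
          rw [← ENNReal.ofReal_tsum_of_nonneg (fun k => ?_) hsum.summable, hsum.tsum_eq]
          have := hδ.1
          positivity
  have huniv : (1 : ℝ≥0∞) ≤ μ G + ENNReal.ofReal δ := by
    calc (1 : ℝ≥0∞) = μ (G ∪ Gᶜ) := by rw [union_compl_self, measure_univ]
      _ ≤ μ G + μ Gᶜ := measure_union_le _ _
      _ ≤ _ := by gcongr
  rw [ENNReal.ofReal_sub _ hδ.1.le, ENNReal.ofReal_one]
  exact tsub_le_iff_right.2 huniv

end EmpiricalProcess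

section Packing

variable {Ξ : Type*} [TopologicalSpace Ξ] [CompactSpace Ξ] {F : Set C(Ξ, ℝ)}

lemma packingNum_antitone (F : Set C(Ξ, ℝ)) : Antitone (packingNum F) := by
  intro s t hst
  refine iSup_le fun T => iSup_le fun hT => ?_
  exact le_iSup₂_of_le T ⟨hT.1, fun f hf g hg hfg => hst.trans (hT.2 hf hg hfg)⟩ le_rfl

/-- A maximal packing of a compact set is a net. -/
lemma exists_finset_net_card_eq_packingNum (hF : IsCompact F) {t : ℝ} (ht : 0 < t) :
    ∃ T : Finset C(Ξ, ℝ), ↑T ⊆ F ∧ (∀ f ∈ F, ∃ g ∈ T, dist f g < t) ∧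
      packingNum F t = T.card := by
  classical
  obtain ⟨C, -, hCfin, hC⟩ := hF.finite_cover_balls (half_pos ht)
  let p : Finset C(Ξ, ℝ) → Prop := fun s =>
    ↑s ⊆ F ∧ (s : Set C(Ξ, ℝ)).Pairwise fun f g => t ≤ dist f g
  have hbound : ∀ s, p s → s.card ≤ hCfin.toFinset.card := by
    intro s hs
    have hx : ∀ f ∈ s, ∃ x ∈ C, dist f x < t / 2 := fun f hf => by
      simpa using hC (hs.1 hf)
    choose! φ hφC hφ using hx
    refine Finset.card_le_card_of_injOn φ (fun f hf => by simpa using hφC f hf) ?_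
    intro f hf g hg hfg
    by_contra hne
    have h1 := hφ f hf
    have h2 := hφ g hg
    rw [← hfg] at h2
    linarith [hs.2 hf hg hne, dist_triangle_right f g (φ f)]
  obtain ⟨m, ⟨T, hT, rfl⟩, hmax⟩ : ∃ m, (∃ s, p s ∧ s.card = m) ∧
      ∀ s, p s → s.card ≤ m := by
    let S : Set ℕ := {m | ∃ s, p s ∧ s.card = m}
    have hne : S.Nonempty := ⟨0, ∅, by simp [p], rfl⟩
    have hbdd : BddAbove S := ⟨_, by rintro _ ⟨s, hs, rfl⟩; exact hbound s hs⟩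
    exact ⟨sSup S, Nat.sSup_mem hne hbdd, fun s hs => le_csSup hbdd ⟨s, hs, rfl⟩⟩
  refine ⟨T, hT.1, fun f hf => ?_, le_antisymm ?_ ?_⟩
  · by_contra! hfar
    have hfT : f ∉ T := fun h => by
      have := hfar f h
      rw [dist_self] at this
      linarith
    have := hmax (insert f T) ⟨by
      rw [Finset.coe_insert]
      exact insert_subset hf hT.1, by
      rw [Finset.coe_insert]
      refine hT.2.insert fun g hg _ => ⟨hfar g hg, ?_⟩
      rw [dist_comm]
      exact hfar g hg⟩
    rw [Finset.card_insert_of_notMem hfT] at this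
    omega
  · exact iSup₂_le fun s hs => by exact_mod_cast hmax s hs
  · exact le_iSup₂_of_le (f := fun (s : Finset C(Ξ, ℝ)) (_ : p s) => (s.card : ℝ≥0∞)) T hT le_rfl

/-- An antitone nonnegative integrable function on `(0, ∞)` has a summable dyadic series. -/
lemma summable_dyadic_of_antitoneOn {g : ℝ → ℝ} (hg : IntegrableOn g (Ioi 0))
    (hanti : AntitoneOn g (Ioi 0)) (hnn : ∀ t, 0 ≤ g t) :
    Summable fun k : ℕ => (1 / 2 : ℝ) ^ k * g ((1 / 2) ^ k) := by
  let a : ℕ → ℝ := fun k => (1 / 2 : ℝ) ^ k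
  have ha : Antitone a := fun _ _ h => pow_le_pow_of_le_one (by norm_num) (by norm_num) h
  have hpos : ∀ k, 0 < a k := fun k => by positivity
  have hsub : ∀ k, Ioc (a (k + 1)) (a k) ⊆ Ioi 0 := fun k x hx => (hpos _).trans hx.1
  have hsum : Summable fun k => ∫ t in Ioc (a (k + 1)) (a k), g t :=
    (hasSum_integral_iUnion (fun k => measurableSet_Ioc)
      ha.pairwise_disjoint_on_Ioc_succ
      (hg.mono_set (iUnion_subset hsub))).summable
  refine Summable.of_nonneg_of_le (fun k => mul_nonneg (hpos k).le (hnn _)) (fun k => ?_)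
    (hsum.mul_left 2)
  have hle : ∫ _ in Ioc (a (k + 1)) (a k), g (a k) ≤ ∫ t in Ioc (a (k + 1)) (a k), g t := by
    refine setIntegral_mono_on (integrableOn_const (by simp)) (hg.mono_set (hsub k))
      measurableSet_Ioc fun t ht => ?_
    exact hanti ((hpos _).trans ht.1) (hpos k) ht.2
  rw [setIntegral_const, Real.volume_real_Ioc_of_le (ha k.le_succ), smul_eq_mul] at hle
  have hk : a k - a (k + 1) = a k / 2 := by simp only [a, pow_succ]; ring
  rw [hk] at hle
  change a k * g (a k) ≤ _
  linarith

end Packing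

section UniformDeviation

variable {Ξ : Type*} [MetricSpace Ξ] [CompactSpace Ξ] [MeasurableSpace Ξ] [BorelSpace Ξ]
  {F : Set C(Ξ, ℝ)}

omit [MeasurableSpace Ξ] [BorelSpace Ξ] in
lemma norm_le_supNormF (hF : IsCompact F) {f : C(Ξ, ℝ)} (hf : f ∈ F) : ‖f‖ ≤ supNormF F := by
  obtain ⟨M, hM⟩ := hF.isBounded.exists_norm_le
  exact le_ciSup (f := fun f : F => ‖(f : C(Ξ, ℝ))‖) ⟨M, by rintro _ ⟨g, rfl⟩; exact hM g g.2⟩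
    ⟨f, hf⟩

lemma sqrt_two_mul_add_le {a k δ : ℝ} (ha : 0 ≤ a) (hk : 1 ≤ k) (hδ : δ ∈ Ioo (0 : ℝ) 1) :
    √(2 * (a + k * Real.log 2 + Real.log δ⁻¹)) ≤
      2 * √a + 2 * k + √(2 * Real.log (2 / δ)) := by
  have h2 : 0 ≤ Real.log 2 := Real.log_nonneg (by norm_num)
  have h2' : Real.log 2 ≤ 1 := by linarith [Real.log_two_lt_d9]
  have hδ' : 0 ≤ Real.log δ⁻¹ := Real.log_nonneg ((one_le_inv₀ hδ.1).2 hδ.2.le)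
  have hlog : Real.log (2 / δ) = Real.log 2 + Real.log δ⁻¹ := by
    rw [div_eq_mul_inv, Real.log_mul two_ne_zero (inv_ne_zero hδ.1.ne')]
  have hsa := Real.sq_sqrt ha
  have hsw := Real.sq_sqrt (show 0 ≤ 2 * Real.log (2 / δ) by rw [hlog]; positivity)
  have hx := Real.sqrt_nonneg a
  have hw := Real.sqrt_nonneg (2 * Real.log (2 / δ))
  rw [Real.sqrt_le_iff]
  refine ⟨by positivity, ?_⟩
  have hk2 : k * Real.log 2 ≤ k ^ 2 := by nlinarith
  have h1 := mul_nonneg hx hw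
  have h3 := mul_nonneg (zero_le_one.trans hk) hw
  have h4 := mul_nonneg (zero_le_one.trans hk) hx
  nlinarith [sq_nonneg k]

/-- Uniform deviation bound over a family with finite Dudley entropy, by chaining. -/
lemma exists_uniform_deviation_bound (hF : IsCompact F) (hne : F.Nonempty)
    (hdudley : IntegrableOn (fun t => √(Real.log ((packingNum F t).toReal))) (Ioi (0 : ℝ)))
    (P : Measure Ξ) [IsProbabilityMeasure P] :
    ∃ A B : ℝ, 0 ≤ A ∧ 0 ≤ B ∧ ∀ δ ∈ Ioo (0 : ℝ) 1, ∀ n : ℕ, n ≠ 0 →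
      ENNReal.ofReal (1 - δ) ≤ Measure.pi (fun _ : Fin n => P)
        {ω | ∀ f ∈ F, deviation P n ω f ≤ (A + B * √(2 * Real.log (2 / δ))) / √n} := by
  classical
  have hpk : ∀ k : ℕ, (0 : ℝ) < (1 / 2) ^ k := fun k => by positivity
  choose T hTF hnet hcard using fun k : ℕ => exists_finset_net_card_eq_packingNum hF (hpk k)
  choose! p hpT hp using hnet
  have hM : ∀ f ∈ F, ‖f‖ ≤ supNormF F := fun f hf => norm_le_supNormF hF hf
  have hM0 : 0 ≤ supNormF F := (norm_nonneg _).trans (hM _ hne.some_mem)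
  set R : ℝ := supNormF F + 2 with hR
  have hR0 : 0 < R := by positivity
  let r : ℕ → ℝ := fun k => R * (1 / 2) ^ k
  have hr : ∀ k, 0 < r k := fun k => mul_pos hR0 (hpk k)
  let N : ℕ → ℝ := fun k => (T k).card
  have hN : ∀ k, 1 ≤ N k := fun k => by
    have : 0 < (T k).card := Finset.card_pos.2 ⟨_, hpT k _ hne.some_mem⟩
    exact Nat.one_le_cast.2 this
  let H : ℕ → Finset C(Ξ, ℝ) := fun k =>
    Nat.casesOn k (T 0) fun k => (T (k + 1)).image fun f => f - p k f
  have hH : ∀ k, ∀ h ∈ H k, ‖h‖ ≤ r k := by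
    rintro (_ | k) h hh
    · have := hM h (hTF 0 hh)
      simp only [r, pow_zero, mul_one]
      linarith
    · obtain ⟨f, hf, rfl⟩ := Finset.mem_image.1 hh
      rw [← dist_eq_norm]
      have h1 := (hp k f (hTF _ hf)).le
      have h2 : (1 / 2 : ℝ) ^ k ≤ r (k + 1) := by
        simp only [r, pow_succ]
        nlinarith [hpk k]
      exact h1.trans h2
  have hHN : ∀ k, ((H k).card : ℝ) ≤ N k := by
    rintro (_ | k)
    · exact le_rfl
    · exact Nat.cast_le.2 Finset.card_image_le
  have hNdef : ∀ k, N k = (packingNum F ((1 / 2) ^ k)).toReal := fun k => by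
    rw [hcard k, ENNReal.toReal_natCast]
  have hr_sum : Summable r :=
    (summable_geometric_of_lt_one (by norm_num) (by norm_num)).mul_left R
  have hsumN : Summable fun k => (1 / 2 : ℝ) ^ k * √(Real.log (N k)) := by
    simp only [hNdef]
    refine summable_dyadic_of_antitoneOn hdudley (fun s hs t ht hst => ?_)
      (fun t => Real.sqrt_nonneg _)
    obtain ⟨U, -, hU, hUc⟩ := exists_finset_net_card_eq_packingNum hF (mem_Ioi.1 hs)
    obtain ⟨V, -, hV, hVc⟩ := exists_finset_net_card_eq_packingNum hF (mem_Ioi.1 ht)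
    have hle := packingNum_antitone F hst
    have hVpos : 0 < V.card := by
      obtain ⟨g, hg, -⟩ := hV _ hne.some_mem
      exact Finset.card_pos.2 ⟨g, hg⟩
    dsimp only
    rw [hUc, hVc] at hle ⊢
    simp only [ENNReal.toReal_natCast]
    have hle' : V.card ≤ U.card := by exact_mod_cast hle
    gcongr
  have hsumk : Summable fun k : ℕ => (1 / 2 : ℝ) ^ k * ((k : ℝ) + 1) := by
    have h1 := summable_pow_mul_geometric_of_norm_lt_one 1 (r := (1 / 2 : ℝ)) (by norm_num)
    have h2 : Summable fun k : ℕ => (1 / 2 : ℝ) ^ k :=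
      summable_geometric_of_lt_one (by norm_num) (by norm_num)
    refine (h1.add h2).congr fun k => ?_
    ring
  have hA_sum : Summable fun k : ℕ => r k * (2 * √(Real.log (N k)) + 2 * ((k : ℝ) + 1)) := by
    refine ((hsumN.add hsumk).mul_left (2 * R)).congr fun k => ?_
    simp only [r]
    ring
  have hA0 : ∀ k : ℕ, 0 ≤ r k * (2 * √(Real.log (N k)) + 2 * ((k : ℝ) + 1)) := fun k => by
    have := hr k
    positivity
  refine ⟨∑' k : ℕ, r k * (2 * √(Real.log (N k)) + 2 * ((k : ℝ) + 1)), ∑' k, r k,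
    tsum_nonneg hA0, tsum_nonneg fun k => (hr k).le, fun δ hδ n hn => ?_⟩
  refine (ofReal_one_sub_le_measure_forall_deviation_le P hn hr hH hN hHN hδ).trans
    (measure_mono fun ω hω => ?_)
  simp only [mem_ofPred_eq] at hω ⊢
  set w := √(2 * Real.log (2 / δ)) with hw
  have hw0 : 0 ≤ w := Real.sqrt_nonneg _
  let u : ℕ → ℝ := fun k => r k * (2 * √(Real.log (N k)) + 2 * ((k : ℝ) + 1)) + r k * w
  have hu0 : ∀ k, 0 ≤ u k := fun k => add_nonneg (hA0 k) (mul_nonneg (hr k).le hw0)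
  have hu : ∀ k, ∀ h ∈ H k, deviation P n ω h ≤ u k / √n := fun k h hh => by
    refine (hω k h hh).trans ?_
    have := sqrt_two_mul_add_le (Real.log_nonneg (hN k)) (k := (k : ℝ) + 1) (by simp) hδ
    rw [show u k = r k * (2 * √(Real.log (N k)) + 2 * ((k : ℝ) + 1) + w) from
      (mul_add _ _ _).symm]
    have := hr k
    gcongr
  have hchain : ∀ k, ∀ f ∈ T k, deviation P n ω f ≤ (∑ j ∈ Finset.range (k + 1), u j) / √n := by
    intro k
    induction k with
    | zero => simpa using! hu 0
    | succ k ih =>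
      intro f hf
      have h1 := ih (p k f) (hpT k f (hTF _ hf))
      have h2 := hu (k + 1) (f - p k f) (Finset.mem_image_of_mem _ hf)
      rw [deviation_sub P hn] at h2
      rw [Finset.sum_range_succ, add_div]
      linarith
  have hu_sum : HasSum u (∑' k : ℕ, r k * (2 * √(Real.log (N k)) + 2 * ((k : ℝ) + 1)) +
      (∑' k, r k) * w) := hA_sum.hasSum.add (hr_sum.hasSum.mul_right w)
  intro f hf
  refine le_of_forall_pos_le_add fun ε hε => ?_
  obtain ⟨k, hk⟩ := exists_pow_lt_of_lt_one (half_pos hε) (show (1 / 2 : ℝ) < 1 by norm_num)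
  have h1 := hchain k _ (hpT k f hf)
  have h2 := deviation_le P hn ω (f - p k f)
  rw [deviation_sub P hn, ← dist_eq_norm] at h2
  have h3 := hp k f hf
  have h4 : (∑ j ∈ Finset.range (k + 1), u j) / √n ≤
      (∑' k : ℕ, r k * (2 * √(Real.log (N k)) + 2 * ((k : ℝ) + 1)) + (∑' k, r k) * w) / √n := by
    gcongr
    exact sum_le_hasSum _ (fun j _ => hu0 j) hu_sum
  linarith

end UniformDeviation

section RobustRisk

variable {Ξ : Type*} [MetricSpace Ξ] [CompactSpace Ξ] [MeasurableSpace Ξ] [BorelSpace Ξ]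
  {c : Ξ → Ξ → ℝ}

/-- Moving a fraction `s` of the mass of `Q` to a point `ζ` bounds the robust risk from below. -/
lemma mixture_le_robustRisk (hc_cont : Continuous fun p : Ξ × Ξ => c p.1 p.2)
    (hc_nonneg : ∀ ξ ζ, 0 ≤ c ξ ζ) (hc_self : ∀ ξ, c ξ ξ = 0) {C s ρ : ℝ}
    (hC : ∀ ξ ζ, c ξ ζ ≤ C) (hs0 : 0 ≤ s) (hs1 : s ≤ 1) (hsρ : s * C ≤ ρ)
    (Q : Measure Ξ) [IsProbabilityMeasure Q] (f : C(Ξ, ℝ)) (ζ : Ξ) :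
    (1 - s) * ∫ ξ, f ξ ∂Q + s * f ζ ≤ robustRisk c ρ Q f := by
  have hs1' : 0 ≤ 1 - s := sub_nonneg.2 hs1
  have hadd : ENNReal.ofReal (1 - s) + ENNReal.ofReal s = 1 := by
    rw [← ENNReal.ofReal_add hs1' hs0]
    simp
  have hdiag : Measurable fun ξ : Ξ => (ξ, ξ) := measurable_id.prodMk measurable_id
  have hconst : Measurable fun ξ : Ξ => (ξ, ζ) := measurable_id.prodMk measurable_const
  have hQ' : IsProbabilityMeasure
      (ENNReal.ofReal (1 - s) • Q + ENNReal.ofReal s • Measure.dirac ζ) :=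
    ⟨by simp [hadd]⟩
  refine le_csSup ⟨‖f‖, ?_⟩ ⟨ENNReal.ofReal (1 - s) • Q + ENNReal.ofReal s • Measure.dirac ζ,
    hQ', ?_, ?_⟩
  · rintro _ ⟨Q', hQ', -, rfl⟩
    exact (abs_le.1 (abs_integral_le_norm Q' f)).2
  · unfold transportCost
    refine le_trans (csInf_le ?_ ⟨ENNReal.ofReal (1 - s) • Q.map (fun ξ => (ξ, ξ)) +
      ENNReal.ofReal s • Q.map (fun ξ => (ξ, ζ)), ⟨?_⟩, ?_, ?_, rfl⟩) ?_
    · refine ⟨0, ?_⟩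
      rintro _ ⟨π, -, -, -, rfl⟩
      exact integral_nonneg fun p => hc_nonneg _ _
    · simp [Measure.map_apply hdiag, Measure.map_apply hconst, hadd]
    · rw [Measure.map_add _ _ measurable_fst, Measure.map_smul, Measure.map_smul,
        Measure.map_map measurable_fst hdiag, Measure.map_map measurable_fst hconst]
      change ENNReal.ofReal (1 - s) • Q.map id + ENNReal.ofReal s • Q.map id = Q
      rw [Measure.map_id, ← add_smul, hadd, one_smul]
    · rw [Measure.map_add _ _ measurable_snd, Measure.map_smul, Measure.map_smul,
        Measure.map_map measurable_snd hdiag, Measure.map_map measurable_snd hconst]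
      change ENNReal.ofReal (1 - s) • Q.map id + ENNReal.ofReal s • Q.map (fun _ => ζ) = _
      rw [Measure.map_id, Measure.map_const, measure_univ, one_smul]
    · have hint : ∀ π : Measure (Ξ × Ξ), IsFiniteMeasure π →
          Integrable (fun p : Ξ × Ξ => c p.1 p.2) π := fun π _ =>
        hc_cont.integrable_of_hasCompactSupport (HasCompactSupport.of_compactSpace _)
      rw [integral_add_measure ((hint _ inferInstance).smul_measure ENNReal.ofReal_ne_top)
        ((hint _ inferInstance).smul_measure ENNReal.ofReal_ne_top),
        integral_smul_measure, integral_smul_measure,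
        integral_map hdiag.aemeasurable hc_cont.aestronglyMeasurable,
        integral_map hconst.aemeasurable hc_cont.aestronglyMeasurable]
      simp only [hc_self, integral_zero, mul_zero, zero_add, smul_eq_mul,
        ENNReal.toReal_ofReal hs0]
      refine le_trans (mul_le_mul_of_nonneg_left ?_ hs0) hsρ
      have := integral_mono_of_nonneg (μ := Q) (Eventually.of_forall fun ξ => hc_nonneg ξ ζ)
        (integrable_const C) (Eventually.of_forall fun ξ => hC ξ ζ)
      simpa using this
  · rw [integral_add_measure
      ((integrable_continuousMap Q f).smul_measure ENNReal.ofReal_ne_top)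
      ((integrable_continuousMap _ f).smul_measure ENNReal.ofReal_ne_top),
      integral_smul_measure, integral_smul_measure, integral_dirac,
      ENNReal.toReal_ofReal hs1', ENNReal.toReal_ofReal hs0, smul_eq_mul, smul_eq_mul]

/-- If the expected cost of reaching the maximizers of `f` is positive, the expectation of `f` is
strictly below its maximum. -/
lemma integral_lt_of_integral_sInf_argmaxSet_pos (hc_nonneg : ∀ ξ ζ, 0 ≤ c ξ ζ)
    (hc_self : ∀ ξ, c ξ ξ = 0) (P : Measure Ξ) [IsProbabilityMeasure P] {f : C(Ξ, ℝ)} {ζ : Ξ}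
    (hζ : ζ ∈ argmaxSet f) (hpos : 0 < ∫ ξ, sInf (c ξ '' argmaxSet f) ∂P) :
    ∫ ξ, f ξ ∂P < f ζ := by
  by_contra! hle
  have hint := integrable_continuousMap P f
  have hzero : ∫ ξ, (f ζ - f ξ) ∂P = 0 := by
    refine le_antisymm ?_ (integral_nonneg fun ξ => sub_nonneg.2 (hζ ξ))
    rw [integral_sub (integrable_const _) hint]
    simpa using hle
  rw [integral_eq_zero_iff_of_nonneg (fun ξ => sub_nonneg.2 (hζ ξ))
    ((integrable_const _).sub hint)] at hzero
  refine hpos.ne' (integral_eq_zero_of_ae ?_)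
  filter_upwards [hzero] with ξ hξ
  have hξ' : ξ ∈ argmaxSet f := fun x => (hζ x).trans (sub_eq_zero.1 hξ).le
  have hnn : ∀ y ∈ c ξ '' argmaxSet f, 0 ≤ y := by
    rintro _ ⟨x, -, rfl⟩
    exact hc_nonneg _ _
  exact le_antisymm (csInf_le ⟨0, hnn⟩ ⟨ξ, hξ', hc_self ξ⟩) (Real.sInf_nonneg hnn)

/-- On a compact family with positive critical radius, expectations stay uniformly below
maxima. -/
lemma exists_uniform_gap [Nonempty Ξ] {F : Set C(Ξ, ℝ)} (hF : IsCompact F) (hne : F.Nonempty)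
    (P : Measure Ξ) [IsProbabilityMeasure P]
    (hlt : ∀ f ∈ F, ∀ ζ ∈ argmaxSet f, ∫ ξ, f ξ ∂P < f ζ) :
    ∃ Δ > 0, ∀ f ∈ F, ∃ ζ, ∫ ξ, f ξ ∂P + Δ ≤ f ζ := by
  have hmax : ∀ f : C(Ξ, ℝ), ∃ ζ, ζ ∈ argmaxSet f := fun f => by
    obtain ⟨ζ, -, h⟩ := isCompact_univ.exists_isMaxOn univ_nonempty f.continuous.continuousOn
    exact ⟨ζ, fun ξ => h (mem_univ ξ)⟩
  choose ζ hζ using hmax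
  have hlip : LipschitzWith 2 fun f : C(Ξ, ℝ) => f (ζ f) - ∫ ξ, f ξ ∂P := by
    refine LipschitzWith.of_le_add_mul _ fun f g => ?_
    have h1 := (abs_le.1 (abs_integral_le_norm P (f - g))).1
    have h2 : f (ζ f) - g (ζ f) ≤ dist f g :=
      (le_abs_self _).trans (ContinuousMap.dist_apply_le_dist (f := f) (g := g) (ζ f))
    have h3 := hζ g (ζ f)
    simp only [ContinuousMap.sub_apply] at h1
    rw [integral_sub (integrable_continuousMap P f) (integrable_continuousMap P g),
      ← dist_eq_norm] at h1
    push_cast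
    linarith
  obtain ⟨g, hg, hmin⟩ := hF.exists_isMinOn hne hlip.continuous.continuousOn
  refine ⟨g (ζ g) - ∫ ξ, g ξ ∂P, sub_pos.2 (hlt g hg _ (hζ g)), fun f hf => ⟨ζ f, ?_⟩⟩
  have : g (ζ g) - ∫ ξ, g ξ ∂P ≤ f (ζ f) - ∫ ξ, f ξ ∂P := hmin hf
  linarith

omit [CompactSpace Ξ] [BorelSpace Ξ] in
lemma rhoCrit_le_integral (hc_nonneg : ∀ ξ ζ, 0 ≤ c ξ ζ) (P : Measure Ξ) {F : Set C(Ξ, ℝ)}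
    {f : C(Ξ, ℝ)} (hf : f ∈ F) : rhoCrit c P F ≤ ∫ ξ, sInf (c ξ '' argmaxSet f) ∂P := by
  refine ciInf_le (f := fun f : F => ∫ ξ, sInf (c ξ '' argmaxSet (f : C(Ξ, ℝ))) ∂P)
    ⟨0, ?_⟩ ⟨f, hf⟩
  rintro _ ⟨g, rfl⟩
  refine integral_nonneg fun ξ => Real.sInf_nonneg ?_
  rintro _ ⟨x, -, rfl⟩
  exact hc_nonneg _ _

omit [BorelSpace Ξ] in
lemma integral_sInf_argmaxSet_le (hc_nonneg : ∀ ξ ζ, 0 ≤ c ξ ζ) {C : ℝ} (hC : ∀ ξ ζ, c ξ ζ ≤ C)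
    (P : Measure Ξ) [IsProbabilityMeasure P] [Nonempty Ξ] (f : C(Ξ, ℝ)) :
    ∫ ξ, sInf (c ξ '' argmaxSet f) ∂P ≤ C := by
  obtain ⟨ζ, -, hζ⟩ := isCompact_univ.exists_isMaxOn univ_nonempty f.continuous.continuousOn
  have hnn : ∀ ξ, ∀ y ∈ c ξ '' argmaxSet f, 0 ≤ y := by
    rintro ξ _ ⟨x, -, rfl⟩
    exact hc_nonneg _ _
  have := integral_mono_of_nonneg (μ := P)
    (Eventually.of_forall fun ξ => Real.sInf_nonneg (hnn ξ)) (integrable_const C)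
    (Eventually.of_forall fun ξ => (csInf_le ⟨0, hnn ξ⟩
      ⟨ζ, fun x => hζ (mem_univ x), rfl⟩).trans (hC ξ ζ))
  simpa using this

end RobustRisk

/-- **Generalization guarantee for Wasserstein robust models** (Theorem 3.1). -/
theorem generalization_wdro
    {Ξ : Type*} [MetricSpace Ξ] [CompactSpace Ξ] [Nonempty Ξ]
    [MeasurableSpace Ξ] [BorelSpace Ξ]
    (c : Ξ → Ξ → ℝ)
    (hc_cont : Continuous fun p : Ξ × Ξ => c p.1 p.2)
    (hc_nonneg : ∀ ξ ζ, 0 ≤ c ξ ζ)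
    (hc_zero : ∀ ξ ζ, c ξ ζ = 0 ↔ ξ = ζ)
    (F : Set C(Ξ, ℝ)) (hFcomp : IsCompact F)
    (hdudley : IntegrableOn (fun t => Real.sqrt (Real.log ((packingNum F t).toReal)))
      (Ioi (0 : ℝ)))
    (P : Measure Ξ) [IsProbabilityMeasure P]
    (hcrit : 0 < rhoCrit c P F) :
    ∃ lamLow : ℝ, 0 < lamLow ∧
      ∀ δ ∈ Ioo (0 : ℝ) 1, ∀ (n : ℕ) (ρ α β : ℝ),
        α = 48 * (supNormF F + 1 / lamLow) * (dudleyEntropy F + 2 / lamLow)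
            + (2 * supNormF F / lamLow) * Real.sqrt (2 * Real.log (2 / δ)) →
        β = 96 * dudleyEntropy F / lamLow
            + (4 * supNormF F / lamLow) * Real.sqrt (2 * Real.log (4 / δ)) →
        (n : ℝ) > 16 * (α + β) ^ 2 / (rhoCrit c P F) ^ 2 →
        ρ > α / Real.sqrt n →
        ENNReal.ofReal (1 - δ) ≤
          Measure.pi (fun _ : Fin n => P)
            {ω | ∀ f ∈ F, ∫ ξ, f ξ ∂P ≤ robustRisk c ρ (empiricalMeasure n ω) ⇑f} := by
  have hc_self : ∀ ξ, c ξ ξ = 0 := fun ξ => (hc_zero ξ ξ).2 rfl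
  have hne : F.Nonempty := by
    rw [nonempty_iff_ne_empty]
    rintro rfl
    simp [rhoCrit] at hcrit
  obtain ⟨f₀, hf₀⟩ := hne
  obtain ⟨C, hC⟩ : ∃ C, ∀ ξ ζ, c ξ ζ ≤ C := by
    obtain ⟨C, hC⟩ := (isCompact_range hc_cont).bddAbove
    exact ⟨C, fun ξ ζ => hC ⟨(ξ, ζ), rfl⟩⟩
  have hcritC : rhoCrit c P F ≤ C := (rhoCrit_le_integral hc_nonneg P hf₀).trans
    (integral_sInf_argmaxSet_le hc_nonneg hC P f₀)
  have hC0 : 0 < C := hcrit.trans_le hcritC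
  obtain ⟨Δ, hΔ, hgap⟩ := exists_uniform_gap hFcomp ⟨f₀, hf₀⟩ P fun f hf ζ hζ =>
    integral_lt_of_integral_sInf_argmaxSet_pos hc_nonneg hc_self P hζ
      (hcrit.trans_le (rhoCrit_le_integral hc_nonneg P hf))
  obtain ⟨A, B, hA, hB, hdev⟩ := exists_uniform_deviation_bound hFcomp ⟨f₀, hf₀⟩ hdudley P
  have hS : 0 < supNormF F := by
    obtain ⟨ζ, hζ⟩ := hgap f₀ hf₀
    have h1 := (abs_le.1 (abs_integral_le_norm P f₀)).1
    have h2 := (abs_le.1 (f₀.norm_coe_le_norm ζ)).2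
    linarith [norm_le_supNormF hFcomp hf₀]
  have hI : 0 ≤ dudleyEntropy F := integral_nonneg fun t => Real.sqrt_nonneg _
  set S := supNormF F
  set I := dudleyEntropy F
  set K : ℝ := 1 + A * C / Δ + B * C / (2 * S * Δ) with hK
  have hKA : A * C / Δ ≤ K := by
    have : 0 ≤ B * C / (2 * S * Δ) := by positivity
    linarith
  have hKB : B * C / (2 * S * Δ) ≤ K := by
    have : 0 ≤ A * C / Δ := by positivity
    linarith
  have hK1 : 1 ≤ K := by
    have : 0 ≤ A * C / Δ := by positivity
    have : 0 ≤ B * C / (2 * S * Δ) := by positivity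
    linarith
  have hK0 : 0 < K := zero_lt_one.trans_le hK1
  refine ⟨K⁻¹, inv_pos.2 hK0, fun δ hδ n ρ α β hα hβ hn hρ => ?_⟩
  simp only [div_inv_eq_mul] at hα hβ
  set w := √(2 * Real.log (2 / δ)) with hw
  have hw0 : 0 ≤ w := Real.sqrt_nonneg _
  have hβ0 : 0 ≤ β := by rw [hβ]; positivity
  have hα0 : 0 ≤ α := by rw [hα]; positivity
  have hn0 : (0 : ℝ) < n := lt_of_le_of_lt (by positivity) hn
  have hn' : n ≠ 0 := by rintro rfl; simp at hn0
  have hsn : 0 < √(n : ℝ) := Real.sqrt_pos.2 hn0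
  have hαC : α / √n ≤ C := by
    refine le_trans ?_ hcritC
    rw [div_le_iff₀ hsn]
    rw [gt_iff_lt, div_lt_iff₀ (by positivity)] at hn
    refine le_of_sq_le_sq ?_ (by positivity)
    rw [mul_pow, Real.sq_sqrt hn0.le]
    nlinarith [mul_nonneg hα0 hβ0, sq_nonneg α, sq_nonneg β]
  have hdom : A + B * w ≤ α * Δ / C := by
    rw [le_div_iff₀ hC0]
    rw [div_le_iff₀ hΔ] at hKA
    rw [div_le_iff₀ (by positivity)] at hKB
    have h1 : K + 2 * S * K * w ≤ α := by
      rw [hα]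
      have : K ≤ 48 * (S + K) * (I + 2 * K) := by
        nlinarith [mul_nonneg hS.le hI, mul_nonneg hS.le hK0.le, mul_nonneg hK0.le hI]
      linarith
    calc (A + B * w) * C = A * C + B * C * w := by ring
      _ ≤ K * Δ + K * (2 * S * Δ) * w := by gcongr
      _ = (K + 2 * S * K * w) * Δ := by ring
      _ ≤ α * Δ := by gcongr
  refine (hdev δ hδ n hn').trans (measure_mono fun ω hω f hf => ?_)
  have := isProbabilityMeasure_empiricalMeasure hn' ω
  obtain ⟨ζ, hζ⟩ := hgap f hf
  set s := α / √n / C with hs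
  have hs0 : 0 ≤ s := by positivity
  refine le_trans ?_ (mixture_le_robustRisk hc_cont hc_nonneg hc_self hC hs0
    ((div_le_one hC0).2 hαC) (by rw [hs, div_mul_cancel₀ _ hC0.ne']; exact hρ.le)
    (empiricalMeasure n ω) f ζ)
  have hs1 : s ≤ 1 := (div_le_one hC0).2 hαC
  have hωf : deviation P n ω f ≤ s * Δ := by
    refine (hω f hf).trans ?_
    calc (A + B * w) / √n ≤ α * Δ / C / √n := by gcongr
      _ = s * Δ := by rw [hs]; ring
  unfold deviation at hωf
  set e := ∫ ξ, f ξ ∂(empiricalMeasure n ω)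
  set m := ∫ ξ, f ξ ∂P
  have h1 := mul_le_mul_of_nonneg_left hζ hs0
  have h2 := mul_le_mul_of_nonneg_left hωf (sub_nonneg.2 hs1)
  have h3 := mul_nonneg (mul_nonneg hs0 hs0) hΔ.le
  linarith
end
end

section
/- One has ρ_max(0) = ρ_crit and lim_{λ → 0⁺} ρ_max(λ) = ρ_crit. In particular, if ρ_crit > 0 then there exists λ_low > 0 such that ρ_max(λ) ≥ ρ_crit/4 for all λ ∈ [0, 2λ_low]. -/
open MeasureTheory Filter Set
open scoped ENNReal NNReal

noncomputable section

/-- Maximizers over `Ξ` of the penalized function `ζ ↦ f ζ - lam * c ξ ζ`. -/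
def penalizedArgmax {Ξ : Type*} [TopologicalSpace Ξ] (c : Ξ → Ξ → ℝ) (lam : ℝ) (f : C(Ξ, ℝ))
    (ξ : Ξ) : Set Ξ :=
  {ζ | ∀ ζ', f ζ' - lam * c ξ ζ' ≤ f ζ - lam * c ξ ζ}

/-- Least cost of moving `ξ` to a maximizer of `ζ ↦ f ζ - lam * c ξ ζ`. -/
def penalizedArgmaxCost {Ξ : Type*} [TopologicalSpace Ξ] (c : Ξ → Ξ → ℝ) (lam : ℝ) (f : C(Ξ, ℝ))
    (ξ : Ξ) : ℝ :=
  sInf (c ξ '' penalizedArgmax c lam f ξ)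

theorem rhoMax_zero {Ξ : Type*} [TopologicalSpace Ξ] [MeasurableSpace Ξ]
    (c : Ξ → Ξ → ℝ) (P : Measure Ξ) (F : Set C(Ξ, ℝ)) : rhoMax c P F 0 = rhoCrit c P F := by
  simp [rhoMax, rhoCrit, argmaxSet]

theorem bddBelow_cost_image {Ξ : Type*} {c : Ξ → Ξ → ℝ} (hc_nonneg : ∀ ξ ζ, 0 ≤ c ξ ζ)
    (ξ : Ξ) (s : Set Ξ) : BddBelow (c ξ '' s) :=
  ⟨0, by rintro _ ⟨ζ, -, rfl⟩; exact hc_nonneg ξ ζ⟩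

section PenalizedArgmaxCost

variable {Ξ : Type*} [TopologicalSpace Ξ] {c : Ξ → Ξ → ℝ}

theorem penalizedArgmaxCost_nonneg (hc_nonneg : ∀ ξ ζ, 0 ≤ c ξ ζ) (lam : ℝ) (f : C(Ξ, ℝ)) (ξ : Ξ) :
    0 ≤ penalizedArgmaxCost c lam f ξ := by
  apply Real.sInf_nonneg
  rintro _ ⟨ζ, -, rfl⟩
  exact hc_nonneg ξ ζ

theorem penalizedArgmaxCost_le (hc_nonneg : ∀ ξ ζ, 0 ≤ c ξ ζ) {lam : ℝ} {f : C(Ξ, ℝ)} {ξ ζ : Ξ}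
    (hζ : ζ ∈ penalizedArgmax c lam f ξ) : penalizedArgmaxCost c lam f ξ ≤ c ξ ζ :=
  csInf_le (bddBelow_cost_image hc_nonneg ξ _) ⟨ζ, hζ, rfl⟩

theorem bddBelow_range_integral_penalizedArgmaxCost [MeasurableSpace Ξ]
    (hc_nonneg : ∀ ξ ζ, 0 ≤ c ξ ζ) (P : Measure Ξ) (F : Set C(Ξ, ℝ)) (lam : ℝ) :
    BddBelow (range fun f : F => ∫ ξ, penalizedArgmaxCost c lam f ξ ∂P) :=
  ⟨0, by
    rintro _ ⟨f, rfl⟩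
    exact integral_nonneg fun ξ => penalizedArgmaxCost_nonneg hc_nonneg lam f ξ⟩

variable [CompactSpace Ξ] [Nonempty Ξ]

theorem penalizedArgmax_nonempty (hc_cont : Continuous fun p : Ξ × Ξ => c p.1 p.2)
    (lam : ℝ) (f : C(Ξ, ℝ)) (ξ : Ξ) : (penalizedArgmax c lam f ξ).Nonempty := by
  have hcξ : Continuous (c ξ) := hc_cont.comp (Continuous.prodMk_right ξ)
  have hcont : Continuous fun ζ => f ζ - lam * c ξ ζ := by fun_prop
  obtain ⟨ζ, -, hζ⟩ := isCompact_univ.exists_isMaxOn univ_nonempty hcont.continuousOn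
  exact ⟨ζ, fun ζ' => hζ (mem_univ ζ')⟩

theorem exists_penalizedArgmaxCost_le (hc_cont : Continuous fun p : Ξ × Ξ => c p.1 p.2)
    (hc_nonneg : ∀ ξ ζ, 0 ≤ c ξ ζ) :
    ∃ M, ∀ lam (f : C(Ξ, ℝ)) ξ, penalizedArgmaxCost c lam f ξ ≤ M := by
  obtain ⟨M, hM⟩ := (isCompact_range hc_cont).bddAbove
  refine ⟨M, fun lam f ξ => ?_⟩
  obtain ⟨ζ, hζ⟩ := penalizedArgmax_nonempty hc_cont lam f ξ
  exact (penalizedArgmaxCost_le hc_nonneg hζ).trans (hM ⟨(ξ, ζ), rfl⟩)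

theorem penalizedArgmaxCost_le_zero_penalty (hc_cont : Continuous fun p : Ξ × Ξ => c p.1 p.2)
    (hc_nonneg : ∀ ξ ζ, 0 ≤ c ξ ζ) {lam : ℝ} (hlam : 0 < lam) (f : C(Ξ, ℝ)) (ξ : Ξ) :
    penalizedArgmaxCost c lam f ξ ≤ penalizedArgmaxCost c 0 f ξ := by
  obtain ⟨ζ, hζ⟩ := penalizedArgmax_nonempty hc_cont lam f ξ
  refine (penalizedArgmaxCost_le hc_nonneg hζ).trans
    (le_csInf ((penalizedArgmax_nonempty hc_cont 0 f ξ).image _) ?_)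
  rintro _ ⟨ζ₀, hζ₀, rfl⟩
  have h₁ := hζ ζ₀
  have h₂ := hζ₀ ζ
  simp only [zero_mul, sub_zero] at h₂
  exact le_of_mul_le_mul_left (by linarith) hlam

theorem lowerSemicontinuous_penalizedArgmaxCost
    (hc_cont : Continuous fun p : Ξ × Ξ => c p.1 p.2) (hc_nonneg : ∀ ξ ζ, 0 ≤ c ξ ζ) :
    LowerSemicontinuous fun p : ℝ × C(Ξ, ℝ) × Ξ => penalizedArgmaxCost c p.1 p.2.1 p.2.2 := by
  intro p a ha
  obtain ⟨b, hab, hb⟩ := exists_between ha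
  have hcc : ∀ {X : Type _} [TopologicalSpace X] {u v : X → Ξ}, Continuous u → Continuous v →
      Continuous fun x => c (u x) (v x) := fun hu hv => hc_cont.comp (hu.prodMk hv)
  have key : ∀ᶠ q : ℝ × C(Ξ, ℝ) × Ξ in nhds p, ∀ ζ ∈ (univ : Set Ξ),
      b < c q.2.2 ζ ∨ ζ ∉ penalizedArgmax c q.1 q.2.1 q.2.2 := by
    refine isCompact_univ.eventually_forall_of_forall_eventually fun ζ _ => ?_
    by_cases hζ : ζ ∈ penalizedArgmax c p.1 p.2.1 p.2.2
    · have hlt : b < c p.2.2 ζ := hb.trans_le (penalizedArgmaxCost_le hc_nonneg hζ)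
      have hcont : Continuous fun z : (ℝ × C(Ξ, ℝ) × Ξ) × Ξ => c z.1.2.2 z.2 :=
        hcc (by fun_prop) (by fun_prop)
      exact ((hcont.tendsto (p, ζ)).eventually_const_lt hlt).mono fun _ h => Or.inl h
    · simp only [penalizedArgmax, mem_ofPred_eq, not_forall, not_le] at hζ
      obtain ⟨ζ', hζ'⟩ := hζ
      have hc₁ : Continuous fun z : (ℝ × C(Ξ, ℝ) × Ξ) × Ξ => c z.1.2.2 z.2 :=
        hcc (by fun_prop) (by fun_prop)
      have hc₂ : Continuous fun z : (ℝ × C(Ξ, ℝ) × Ξ) × Ξ => c z.1.2.2 ζ' :=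
        hcc (by fun_prop) (by fun_prop)
      have h₁ : Continuous fun z : (ℝ × C(Ξ, ℝ) × Ξ) × Ξ =>
          z.1.2.1 z.2 - z.1.1 * c z.1.2.2 z.2 := by fun_prop
      have h₂ : Continuous fun z : (ℝ × C(Ξ, ℝ) × Ξ) × Ξ =>
          z.1.2.1 ζ' - z.1.1 * c z.1.2.2 ζ' := by fun_prop
      exact ((h₁.tendsto (p, ζ)).eventually_lt (h₂.tendsto (p, ζ)) hζ').mono
        fun _ h => Or.inr fun hmem => (hmem ζ').not_gt h
  filter_upwards [key] with q hq
  refine hab.trans_le (le_csInf ((penalizedArgmax_nonempty hc_cont _ _ _).image _) ?_)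
  rintro _ ⟨ζ, hζ, rfl⟩
  exact ((hq ζ (mem_univ ζ)).resolve_right (not_not_intro hζ)).le

variable [MeasurableSpace Ξ] [BorelSpace Ξ]

theorem measurable_penalizedArgmaxCost (hc_cont : Continuous fun p : Ξ × Ξ => c p.1 p.2)
    (hc_nonneg : ∀ ξ ζ, 0 ≤ c ξ ζ) (lam : ℝ) (f : C(Ξ, ℝ)) :
    Measurable (penalizedArgmaxCost c lam f) :=
  ((lowerSemicontinuous_penalizedArgmaxCost hc_cont hc_nonneg).comp
    (g := fun ξ : Ξ => (lam, f, ξ)) (by fun_prop)).measurable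

theorem integrable_penalizedArgmaxCost (hc_cont : Continuous fun p : Ξ × Ξ => c p.1 p.2)
    (hc_nonneg : ∀ ξ ζ, 0 ≤ c ξ ζ) (P : Measure Ξ) [IsFiniteMeasure P] (lam : ℝ) (f : C(Ξ, ℝ)) :
    Integrable (penalizedArgmaxCost c lam f) P := by
  obtain ⟨M, hM⟩ := exists_penalizedArgmaxCost_le hc_cont hc_nonneg
  refine Integrable.of_bound
    (measurable_penalizedArgmaxCost hc_cont hc_nonneg lam f).aestronglyMeasurable M
    (ae_of_all _ fun ξ => ?_)
  rw [Real.norm_of_nonneg (penalizedArgmaxCost_nonneg hc_nonneg lam f ξ)]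
  exact hM lam f ξ

theorem lowerSemicontinuous_integral_penalizedArgmaxCost
    (hc_cont : Continuous fun p : Ξ × Ξ => c p.1 p.2) (hc_nonneg : ∀ ξ ζ, 0 ≤ c ξ ζ)
    (P : Measure Ξ) [IsFiniteMeasure P] :
    LowerSemicontinuous fun q : ℝ × C(Ξ, ℝ) => ∫ ξ, penalizedArgmaxCost c q.1 q.2 ξ ∂P := by
  rintro ⟨lam, f⟩ a ha
  have hlim : Tendsto (fun q : ℝ × C(Ξ, ℝ) =>
      ∫ ξ, min (penalizedArgmaxCost c q.1 q.2 ξ) (penalizedArgmaxCost c lam f ξ) ∂P)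
      (nhds (lam, f)) (nhds (∫ ξ, penalizedArgmaxCost c lam f ξ ∂P)) := by
    refine tendsto_integral_filter_of_dominated_convergence (penalizedArgmaxCost c lam f)
      (Eventually.of_forall fun q => ?_) (Eventually.of_forall fun q => ae_of_all _ fun ξ => ?_)
      (integrable_penalizedArgmaxCost hc_cont hc_nonneg P lam f) (ae_of_all _ fun ξ => ?_)
    · exact ((measurable_penalizedArgmaxCost hc_cont hc_nonneg q.1 q.2).min
        (measurable_penalizedArgmaxCost hc_cont hc_nonneg lam f)).aestronglyMeasurable
    · rw [Real.norm_of_nonneg (le_min (penalizedArgmaxCost_nonneg hc_nonneg _ _ _)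
        (penalizedArgmaxCost_nonneg hc_nonneg _ _ _))]
      exact min_le_right _ _
    · refine tendsto_order.2 ⟨fun b hb => ?_, fun b hb =>
        Eventually.of_forall fun q => (min_le_right _ _).trans_lt hb⟩
      have hlsc := (lowerSemicontinuous_penalizedArgmaxCost hc_cont hc_nonneg).comp
        (g := fun q : ℝ × C(Ξ, ℝ) => (q.1, q.2, ξ)) (by fun_prop)
      filter_upwards [hlsc (lam, f) b hb] with q hq
      exact lt_min hq hb
  filter_upwards [hlim.eventually_const_lt ha] with q hq
  refine hq.trans_le (integral_mono_of_nonneg (ae_of_all _ fun ξ => ?_)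
    (integrable_penalizedArgmaxCost hc_cont hc_nonneg P q.1 q.2)
    (ae_of_all _ fun ξ => min_le_left _ _))
  exact le_min (penalizedArgmaxCost_nonneg hc_nonneg _ _ _)
    (penalizedArgmaxCost_nonneg hc_nonneg _ _ _)

theorem rhoMax_le_rhoCrit (hc_cont : Continuous fun p : Ξ × Ξ => c p.1 p.2)
    (hc_nonneg : ∀ ξ ζ, 0 ≤ c ξ ζ) (P : Measure Ξ) [IsFiniteMeasure P] (F : Set C(Ξ, ℝ))
    {lam : ℝ} (hlam : 0 < lam) : rhoMax c P F lam ≤ rhoCrit c P F := by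
  rw [← rhoMax_zero]
  exact ciInf_mono (bddBelow_range_integral_penalizedArgmaxCost hc_nonneg P F lam) fun f =>
    integral_mono (integrable_penalizedArgmaxCost hc_cont hc_nonneg P lam f)
      (integrable_penalizedArgmaxCost hc_cont hc_nonneg P 0 f)
      (penalizedArgmaxCost_le_zero_penalty hc_cont hc_nonneg hlam f)

theorem eventually_le_rhoMax (hc_cont : Continuous fun p : Ξ × Ξ => c p.1 p.2)
    (hc_nonneg : ∀ ξ ζ, 0 ≤ c ξ ζ) (P : Measure Ξ) [IsFiniteMeasure P] {F : Set C(Ξ, ℝ)}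
    (hF : IsCompact F) {a : ℝ} (ha : a < rhoCrit c P F) :
    ∀ᶠ lam in nhds (0 : ℝ), a ≤ rhoMax c P F lam := by
  rcases F.eq_empty_or_nonempty with rfl | hne
  · simp only [rhoCrit, Real.iInf_of_isEmpty] at ha
    simp [rhoMax, Real.iInf_of_isEmpty, ha.le]
  have key : ∀ᶠ lam in nhds (0 : ℝ), ∀ f ∈ F, a < ∫ ξ, penalizedArgmaxCost c lam f ξ ∂P := by
    refine hF.eventually_forall_of_forall_eventually fun f hf => ?_
    refine lowerSemicontinuous_integral_penalizedArgmaxCost hc_cont hc_nonneg P (0, f) a ?_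
    rw [← rhoMax_zero] at ha
    exact ha.trans_le
      (ciInf_le (bddBelow_range_integral_penalizedArgmaxCost hc_nonneg P F 0) ⟨f, hf⟩)
  have : Nonempty F := hne.to_subtype
  filter_upwards [key] with lam h
  exact le_ciInf fun f => (h f f.2).le

end PenalizedArgmaxCost

/-- **Continuity at zero of the maximal radius** (Lemma 4.1 / Lemma D.1):
`ρ_max(0) = ρ_crit`, `ρ_max(λ) → ρ_crit` as `λ → 0⁺`, and if `ρ_crit > 0` there is
`λ_low > 0` with `ρ_max(λ) ≥ ρ_crit/4` on `[0, 2λ_low]`. -/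
theorem rhoMax_tendsto_rhoCrit
    {Ξ : Type*} [MetricSpace Ξ] [CompactSpace Ξ] [Nonempty Ξ]
    [MeasurableSpace Ξ] [BorelSpace Ξ]
    (c : Ξ → Ξ → ℝ)
    (hc_cont : Continuous fun p : Ξ × Ξ => c p.1 p.2)
    (hc_nonneg : ∀ ξ ζ, 0 ≤ c ξ ζ)
    (hc_zero : ∀ ξ ζ, c ξ ζ = 0 ↔ ξ = ζ)
    (F : Set C(Ξ, ℝ)) (hFcomp : IsCompact F)
    (P : Measure Ξ) [IsProbabilityMeasure P] :
    rhoMax c P F 0 = rhoCrit c P F ∧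
    Tendsto (rhoMax c P F) (nhdsWithin 0 (Ioi 0)) (nhds (rhoCrit c P F)) ∧
    (0 < rhoCrit c P F →
      ∃ lamLow : ℝ, 0 < lamLow ∧
        ∀ lam ∈ Icc (0 : ℝ) (2 * lamLow), rhoCrit c P F / 4 ≤ rhoMax c P F lam) := by
  refine ⟨rhoMax_zero c P F, tendsto_order.2 ⟨fun a ha => ?_, fun a ha => ?_⟩, fun hpos => ?_⟩
  · obtain ⟨b, hab, hb⟩ := exists_between ha
    filter_upwards [nhdsWithin_le_nhds (eventually_le_rhoMax hc_cont hc_nonneg P hFcomp hb)]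
      with lam h using hab.trans_le h
  · filter_upwards [self_mem_nhdsWithin] with lam hlam
    exact (rhoMax_le_rhoCrit hc_cont hc_nonneg P F hlam).trans_lt ha
  · obtain ⟨ε, hε, h⟩ := Metric.eventually_nhds_iff.1 (eventually_le_rhoMax hc_cont hc_nonneg P
      hFcomp (show rhoCrit c P F / 4 < rhoCrit c P F by linarith))
    refine ⟨ε / 4, by positivity, fun lam hlam => h ?_⟩
    rw [Real.dist_eq, sub_zero, abs_of_nonneg hlam.1]
    linarith [hlam.2]
end
end

section
/- For every probability measure Q on Ξ, every ρ > 0 and every continuous function f : Ξ → ℝ, strong duality holds: sup { E_{ξ∼Q'}[f(ξ)] : Q' a probability measure on Ξ with W_c(Q, Q') ≤ ρ } = inf_{λ ≥ 0} { λρ + E_{ξ∼Q}[φ(λ, f, ξ)] }. -/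
open MeasureTheory Filter Set
open scoped ENNReal NNReal

noncomputable section

theorem Continuous.integrable_of_compactSpace {X : Type*} [TopologicalSpace X] [CompactSpace X]
    [MeasurableSpace X] [OpensMeasurableSpace X] {μ : Measure X} [IsFiniteMeasure μ]
    {g : X → ℝ} (hg : Continuous g) : Integrable g μ :=
  hg.integrable_of_hasCompactSupport (HasCompactSupport.of_compactSpace g)

theorem continuous_section_dualGen {Ξ : Type*} [TopologicalSpace Ξ] {c : Ξ → Ξ → ℝ}
    (hc : Continuous fun p : Ξ × Ξ => c p.1 p.2)
    (f : C(Ξ, ℝ)) (lam : ℝ) (ξ : Ξ) : Continuous fun ζ => f ζ - lam * c ξ ζ :=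
  f.continuous.sub (continuous_const.mul (hc.comp (Continuous.prodMk_right ξ)))

theorem le_dualGen {Ξ : Type*} [TopologicalSpace Ξ] [CompactSpace Ξ] {c : Ξ → Ξ → ℝ}
    (hc : Continuous fun p : Ξ × Ξ => c p.1 p.2)
    (f : C(Ξ, ℝ)) (lam : ℝ) (ξ ζ : Ξ) : f ζ - lam * c ξ ζ ≤ dualGen c lam f ξ :=
  le_ciSup (isCompact_range (continuous_section_dualGen hc f lam ξ)).bddAbove ζ

theorem continuous_dualGen {Ξ : Type*} [TopologicalSpace Ξ] [CompactSpace Ξ] {c : Ξ → Ξ → ℝ}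
    (hc : Continuous fun p : Ξ × Ξ => c p.1 p.2)
    (f : C(Ξ, ℝ)) (lam : ℝ) : Continuous (dualGen c lam f) := by
  have h := isCompact_univ.continuous_sSup (K := (univ : Set Ξ))
    (f := fun ξ ζ => f ζ - lam * c ξ ζ)
    ((f.continuous.comp continuous_snd).sub (continuous_const.mul hc))
  simp only [image_univ] at h
  exact h

theorem transportCost_le_integral {Ξ : Type*} [MeasurableSpace Ξ] {c : Ξ → Ξ → ℝ}
    (hc_nonneg : ∀ ξ ζ, 0 ≤ c ξ ζ)
    (π : Measure (Ξ × Ξ)) [IsProbabilityMeasure π] :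
    transportCost c (π.map Prod.fst) (π.map Prod.snd) ≤ ∫ p, c p.1 p.2 ∂π :=
  csInf_le ⟨0, by
    rintro r ⟨π', -, -, -, rfl⟩
    exact integral_nonneg fun p => hc_nonneg p.1 p.2⟩ ⟨π, inferInstance, rfl, rfl, rfl⟩

/-- Cost and reward pairs attained by the couplings with first marginal `Q`. -/
def costRewardSet {Ξ : Type*} [MeasurableSpace Ξ] (c : Ξ → Ξ → ℝ) (Q : Measure Ξ)
    (f : Ξ → ℝ) : Set (ℝ × ℝ) :=
  {k | ∃ π : Measure (Ξ × Ξ), IsProbabilityMeasure π ∧ π.map Prod.fst = Q ∧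
    k = (∫ p, c p.1 p.2 ∂π, ∫ p, f p.2 ∂π)}

open scoped Pointwise in
/-- Lagrange multiplier for a planar convex program satisfying Slater's condition. -/
theorem exists_multiplier_of_convex {K : Set (ℝ × ℝ)} (hK : Convex ℝ K) {ρ v : ℝ}
    (hslater : ∃ k ∈ K, k.1 < ρ) (hv : ∀ k ∈ K, k.1 ≤ ρ → k.2 ≤ v) :
    ∃ lam : ℝ, 0 ≤ lam ∧ ∀ k ∈ K, k.2 - lam * k.1 ≤ v - lam * ρ := by
  let C : Set (ℝ × ℝ) := Ioi 0 ×ˢ Iio 0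
  have hCo : IsOpen (K + C) := (isOpen_Ioi.prod isOpen_Iio).add_left
  have hCc : Convex ℝ (K + C) := hK.add ((convex_Ioi 0).prod (convex_Iio 0))
  have hnot : (ρ, v) ∉ K + C := by
    rintro ⟨k, hk, d, ⟨hd₁, hd₂⟩, hkd⟩
    have e₁ : k.1 + d.1 = ρ := congrArg Prod.fst hkd
    have e₂ : k.2 + d.2 = v := congrArg Prod.snd hkd
    have := hv k hk (by simp only [mem_Ioi] at hd₁; linarith)
    simp only [mem_Iio] at hd₂
    linarith
  obtain ⟨g, hg⟩ := geometric_hahn_banach_open_point hCc hCo hnot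
  set α := g (1, 0)
  set β := g (0, 1)
  have hgab : ∀ a b : ℝ, g (a, b) = a * α + b * β := by
    intro a b
    have : ((a, b) : ℝ × ℝ) = a • (1, 0) + b • (0, 1) := by simp
    rw [this, map_add, map_smul, map_smul, smul_eq_mul, smul_eq_mul]
  have hlt : ∀ k ∈ K, ∀ s > 0, ∀ t > 0, (k.1 + s) * α + (k.2 - t) * β < ρ * α + v * β := by
    intro k hk s hs t ht
    rw [← hgab, ← hgab]
    refine hg _ ⟨k, hk, (s, -t), ⟨hs, by simpa using ht⟩, ?_⟩
    simp [Prod.ext_iff, sub_eq_add_neg]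
  have hle : ∀ k ∈ K, ∀ s ≥ 0, ∀ t ≥ 0, (k.1 + s) * α + (k.2 - t) * β ≤ ρ * α + v * β := by
    intro k hk s hs t ht
    have htend : Tendsto (fun ε : ℝ => (k.1 + (s + ε)) * α + (k.2 - (t + ε)) * β)
        (nhdsWithin 0 (Ioi 0)) (nhds ((k.1 + (s + 0)) * α + (k.2 - (t + 0)) * β)) :=
      (Continuous.tendsto (by fun_prop) 0).mono_left nhdsWithin_le_nhds
    rw [add_zero, add_zero] at htend
    refine le_of_tendsto htend (eventually_nhdsWithin_of_forall fun ε hε => ?_)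
    exact (hlt k hk _ (add_pos_of_nonneg_of_pos hs hε) _ (add_pos_of_nonneg_of_pos ht hε)).le
  obtain ⟨k₀, hk₀, hk₀ρ⟩ := hslater
  have hα_nonpos : α ≤ 0 := by
    by_contra! hpos
    have h := hle k₀ hk₀ ((|ρ * α + v * β - k₀.1 * α - k₀.2 * β| + 1) / α) (by positivity) 0 le_rfl
    rw [add_mul, div_mul_cancel₀ _ hpos.ne'] at h
    linarith [le_abs_self (ρ * α + v * β - k₀.1 * α - k₀.2 * β)]
  have hβ_nonneg : 0 ≤ β := by
    by_contra! hneg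
    have h := hle k₀ hk₀ 0 le_rfl ((|ρ * α + v * β - k₀.1 * α - k₀.2 * β| + 1) / (-β))
      (div_nonneg (by positivity) (by linarith))
    rw [sub_mul, div_neg, neg_mul, div_mul_cancel₀ _ hneg.ne] at h
    linarith [le_abs_self (ρ * α + v * β - k₀.1 * α - k₀.2 * β)]
  have hβ_pos : 0 < β := by
    refine hβ_nonneg.lt_of_ne fun h0 => ?_
    have h := hlt k₀ hk₀ ((ρ - k₀.1) / 2) (by linarith) 1 one_pos
    rw [← h0] at h
    nlinarith
  refine ⟨-α / β, div_nonneg (by linarith) hβ_pos.le, fun k hk => ?_⟩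
  have h := hle k hk 0 le_rfl 0 le_rfl
  have e : -α / β * β = -α := div_mul_cancel₀ _ hβ_pos.ne'
  refine le_of_mul_le_mul_right ?_ hβ_pos
  calc (k.2 - -α / β * k.1) * β = k.2 * β - k.1 * (-α / β * β) := by ring
    _ ≤ v * β - ρ * (-α / β * β) := by rw [e]; linarith
    _ = (v - -α / β * ρ) * β := by ring

section WassersteinDuality

variable {Ξ : Type*} [MetricSpace Ξ] [CompactSpace Ξ] [MeasurableSpace Ξ] [BorelSpace Ξ]
  {c : Ξ → Ξ → ℝ}

/-- An `ε`-optimal maximizer in the dual generator can be selected measurably. -/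
theorem exists_measurable_dualGen_sub_lt [Nonempty Ξ]
    (hc : Continuous fun p : Ξ × Ξ => c p.1 p.2) (f : C(Ξ, ℝ)) (lam : ℝ)
    {ε : ℝ} (hε : 0 < ε) :
    ∃ T : Ξ → Ξ, Measurable T ∧ ∀ ξ, dualGen c lam f ξ - ε < f (T ξ) - lam * c ξ (T ξ) := by
  classical
  let z := TopologicalSpace.denseSeq Ξ
  have hex : ∀ ξ, ∃ n, dualGen c lam f ξ - ε < f (z n) - lam * c ξ (z n) := by
    intro ξ
    obtain ⟨ζ, hζ⟩ := exists_lt_of_lt_ciSup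
      (show dualGen c lam f ξ - ε < ⨆ ζ, (f ζ - lam * c ξ ζ) from sub_lt_self _ hε)
    exact (TopologicalSpace.denseRange_denseSeq Ξ).exists_mem_open
      (isOpen_lt continuous_const (continuous_section_dualGen hc f lam ξ)) ⟨ζ, hζ⟩
  refine ⟨fun ξ => z (Nat.find (hex ξ)), ?_, fun ξ => Nat.find_spec (hex ξ)⟩
  refine (measurable_from_nat (f := z)).comp (measurable_find hex fun n => ?_)
  exact (isOpen_lt ((continuous_dualGen hc f lam).sub continuous_const)
    (continuous_const.sub (continuous_const.mul
      (hc.comp (Continuous.prodMk_left (z n)))))).measurableSet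

/-- Weak duality. -/
theorem integral_le_of_transportCost_le (hc : Continuous fun p : Ξ × Ξ => c p.1 p.2)
    {Q Q' : Measure Ξ} [IsProbabilityMeasure Q] [IsProbabilityMeasure Q'] {ρ : ℝ}
    (h : transportCost c Q Q' ≤ ρ) (f : C(Ξ, ℝ)) {lam : ℝ} (hlam : 0 ≤ lam) :
    ∫ ξ, f ξ ∂Q' ≤ lam * ρ + ∫ ξ, dualGen c lam f ξ ∂Q := by
  have key : ∀ ε > 0, ∫ ξ, f ξ ∂Q' ≤ lam * (ρ + ε) + ∫ ξ, dualGen c lam f ξ ∂Q := by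
    intro ε hε
    obtain ⟨_, ⟨π, hπ, h₁, h₂, rfl⟩, hlt⟩ := exists_lt_of_csInf_lt
      (show {r | ∃ π : Measure (Ξ × Ξ), IsProbabilityMeasure π ∧ π.map Prod.fst = Q ∧
          π.map Prod.snd = Q' ∧ r = ∫ p, c p.1 p.2 ∂π}.Nonempty from
        ⟨_, Q.prod Q', inferInstance, by simp, by simp, rfl⟩)
      (h.trans_lt (lt_add_of_pos_right ρ hε))
    have hφ := continuous_dualGen hc f lam
    have e₁ : ∫ p, dualGen c lam f p.1 ∂π = ∫ ξ, dualGen c lam f ξ ∂Q := by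
      rw [← h₁, integral_map measurable_fst.aemeasurable hφ.aestronglyMeasurable]
    have e₂ : ∫ p, f p.2 ∂π = ∫ ξ, f ξ ∂Q' := by
      rw [← h₂, integral_map measurable_snd.aemeasurable f.continuous.aestronglyMeasurable]
    have hi : Integrable (fun p : Ξ × Ξ => lam * c p.1 p.2) π :=
      (continuous_const.mul hc).integrable_of_compactSpace
    have hi' : Integrable (fun p : Ξ × Ξ => dualGen c lam f p.1) π :=
      (hφ.comp continuous_fst).integrable_of_compactSpace
    have hle : ∫ p, f p.2 ∂π ≤ ∫ p, (lam * c p.1 p.2 + dualGen c lam f p.1) ∂π := by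
      refine integral_mono (f.continuous.comp continuous_snd).integrable_of_compactSpace
        (hi.add hi') fun p => ?_
      have := le_dualGen hc f lam p.1 p.2
      change f p.2 ≤ lam * c p.1 p.2 + dualGen c lam f p.1
      linarith
    rw [integral_add hi hi', integral_const_mul, e₁, e₂] at hle
    have := mul_le_mul_of_nonneg_left hlt.le hlam
    linarith
  have ht : Tendsto (fun ε : ℝ => lam * (ρ + ε) + ∫ ξ, dualGen c lam f ξ ∂Q)
      (nhdsWithin 0 (Ioi 0)) (nhds (lam * (ρ + 0) + ∫ ξ, dualGen c lam f ξ ∂Q)) :=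
    (Continuous.tendsto (by fun_prop) 0).mono_left nhdsWithin_le_nhds
  rw [add_zero] at ht
  exact ge_of_tendsto ht (eventually_nhdsWithin_of_forall key)

theorem convex_costRewardSet (hc : Continuous fun p : Ξ × Ξ => c p.1 p.2)
    (Q : Measure Ξ) (f : C(Ξ, ℝ)) : Convex ℝ (costRewardSet c Q f) := by
  rintro _ ⟨π₁, hπ₁, h₁, rfl⟩ _ ⟨π₂, hπ₂, h₂, rfl⟩ a b ha hb hab
  have hab' : ENNReal.ofReal a + ENNReal.ofReal b = 1 := by
    rw [← ENNReal.ofReal_add ha hb, hab, ENNReal.ofReal_one]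
  have hint : ∀ g : Ξ × Ξ → ℝ, Continuous g →
      ∫ p, g p ∂(ENNReal.ofReal a • π₁ + ENNReal.ofReal b • π₂)
        = a * ∫ p, g p ∂π₁ + b * ∫ p, g p ∂π₂ := by
    intro g hg
    rw [integral_add_measure
      (hg.integrable_of_compactSpace.smul_measure ENNReal.ofReal_ne_top)
      (hg.integrable_of_compactSpace.smul_measure ENNReal.ofReal_ne_top),
      integral_smul_measure, integral_smul_measure, ENNReal.toReal_ofReal ha,
      ENNReal.toReal_ofReal hb, smul_eq_mul, smul_eq_mul]
  refine ⟨ENNReal.ofReal a • π₁ + ENNReal.ofReal b • π₂, ⟨by simp [hab']⟩, ?_, ?_⟩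
  · rw [Measure.map_add _ _ measurable_fst, Measure.map_smul, Measure.map_smul, h₁, h₂,
      ← add_smul, hab', one_smul]
  · rw [hint _ hc, hint _ (f.continuous.comp' continuous_snd)]
    simp

theorem mem_costRewardSet_of_measurable (hc : Continuous fun p : Ξ × Ξ => c p.1 p.2)
    (Q : Measure Ξ) [IsProbabilityMeasure Q] (f : C(Ξ, ℝ)) {T : Ξ → Ξ} (hT : Measurable T) :
    (∫ ξ, c ξ (T ξ) ∂Q, ∫ ξ, f (T ξ) ∂Q) ∈ costRewardSet c Q f := by
  have hm : Measurable fun ξ => (ξ, T ξ) := measurable_id.prodMk hT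
  refine ⟨Q.map fun ξ => (ξ, T ξ), Measure.isProbabilityMeasure_map hm.aemeasurable, ?_, ?_⟩
  · rw [Measure.map_map measurable_fst hm]
    exact Measure.map_id
  · rw [integral_map hm.aemeasurable hc.aestronglyMeasurable, integral_map hm.aemeasurable
      (f.continuous.comp' continuous_snd).aestronglyMeasurable]

theorem lagrangian_le_of_costRewardSet_le [Nonempty Ξ]
    (hc : Continuous fun p : Ξ × Ξ => c p.1 p.2)
    (Q : Measure Ξ) [IsProbabilityMeasure Q] (f : C(Ξ, ℝ)) {lam w : ℝ}
    (h : ∀ k ∈ costRewardSet c Q f, k.2 - lam * k.1 ≤ w) :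
    ∫ ξ, dualGen c lam f ξ ∂Q ≤ w := by
  refine le_of_forall_pos_le_add fun ε hε => ?_
  obtain ⟨T, hT, hTε⟩ := exists_measurable_dualGen_sub_lt hc f lam hε
  have hm : Measurable fun ξ => (ξ, T ξ) := measurable_id.prodMk hT
  have hint : ∀ g : Ξ × Ξ → ℝ, Continuous g → Integrable (fun ξ => g (ξ, T ξ)) Q := by
    intro g hg
    have := Measure.isProbabilityMeasure_map (μ := Q) hm.aemeasurable
    exact (hg.integrable_of_compactSpace (μ := Q.map fun ξ => (ξ, T ξ))).comp_measurable hm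
  have hi₁ := hint (fun p => f p.2) (f.continuous.comp continuous_snd)
  have hi₂ := (hint _ hc).const_mul lam
  have hφ : Integrable (dualGen c lam f) Q :=
    (continuous_dualGen hc f lam).integrable_of_compactSpace
  have hle : ∫ ξ, (dualGen c lam f ξ - ε) ∂Q ≤ ∫ ξ, (f (T ξ) - lam * c ξ (T ξ)) ∂Q :=
    integral_mono (hφ.sub (integrable_const ε)) (hi₁.sub hi₂) fun ξ => (hTε ξ).le
  rw [integral_sub hφ (integrable_const ε), integral_sub hi₁ hi₂, integral_const_mul,
    integral_const, probReal_univ, one_smul] at hle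
  have := h _ (mem_costRewardSet_of_measurable hc Q f hT)
  simp only at this
  linarith

end WassersteinDuality

/-- **Strong duality for standard WDRO** (Proposition B.1). -/
theorem strong_duality_wdro
    {Ξ : Type*} [MetricSpace Ξ] [CompactSpace Ξ] [Nonempty Ξ]
    [MeasurableSpace Ξ] [BorelSpace Ξ]
    (c : Ξ → Ξ → ℝ)
    (hc_cont : Continuous fun p : Ξ × Ξ => c p.1 p.2)
    (hc_nonneg : ∀ ξ ζ, 0 ≤ c ξ ζ)
    (hc_zero : ∀ ξ ζ, c ξ ζ = 0 ↔ ξ = ζ)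
    (Q : Measure Ξ) [IsProbabilityMeasure Q] (ρ : ℝ) (hρ : 0 < ρ) (f : C(Ξ, ℝ)) :
    sSup { r | ∃ Q' : Measure Ξ, IsProbabilityMeasure Q' ∧ transportCost c Q Q' ≤ ρ ∧
        r = ∫ ξ, f ξ ∂Q' } =
      sInf ((fun lam => lam * ρ + ∫ ξ, dualGen c lam (⇑f) ξ ∂Q) '' Ici (0 : ℝ)) := by
  set S := {r | ∃ Q' : Measure Ξ, IsProbabilityMeasure Q' ∧ transportCost c Q Q' ≤ ρ ∧
    r = ∫ ξ, f ξ ∂Q'}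
  have weak : ∀ r ∈ S, ∀ lam ∈ Ici (0 : ℝ),
      r ≤ lam * ρ + ∫ ξ, dualGen c lam (⇑f) ξ ∂Q := by
    rintro r ⟨Q', hQ', hW, rfl⟩ lam hlam
    exact integral_le_of_transportCost_le hc_cont hW f hlam
  have hmem : ∀ k ∈ costRewardSet c Q f, k.1 ≤ ρ → k.2 ∈ S := by
    rintro _ ⟨π, hπ, rfl, rfl⟩ hk
    refine ⟨π.map Prod.snd, Measure.isProbabilityMeasure_map measurable_snd.aemeasurable,
      (transportCost_le_integral hc_nonneg π).trans hk, ?_⟩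
    rw [integral_map measurable_snd.aemeasurable f.continuous.aestronglyMeasurable]
  have hid := mem_costRewardSet_of_measurable hc_cont Q f measurable_id
  have hid_lt : (∫ ξ, c ξ (id ξ) ∂Q) < ρ := by
    simpa [(hc_zero _ _).2 rfl] using hρ
  have hne : S.Nonempty := ⟨_, hmem _ hid hid_lt.le⟩
  have hbdd : BddAbove S := ⟨_, fun r hr => weak r hr 0 self_mem_Ici⟩
  apply le_antisymm
  · refine csSup_le hne fun r hr => le_csInf (nonempty_Ici.image _) ?_
    rintro _ ⟨lam, hlam, rfl⟩
    exact weak r hr lam hlam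
  · obtain ⟨lam, hlam, hle⟩ := exists_multiplier_of_convex (convex_costRewardSet hc_cont Q f)
      ⟨_, hid, hid_lt⟩ fun k hk hkρ => le_csSup hbdd (hmem k hk hkρ)
    have hφ := lagrangian_le_of_costRewardSet_le hc_cont Q f hle
    obtain ⟨r, hr⟩ := hne
    refine (csInf_le ⟨r, ?_⟩ (mem_image_of_mem _ hlam)).trans ?_
    · rintro _ ⟨l, hl, rfl⟩
      exact weak r hr l hl
    · change lam * ρ + ∫ ξ, dualGen c lam (⇑f) ξ ∂Q ≤ sSup S
      linarith
end
end
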